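/- Fix a prime p, m, n ∈ ℕ, a commutative ring R, and truncated p-typical Witt vectors a = (a_0,…,a_{m−1}) ∈ W_m(R), b = (b_0,…,b_{n−1}) ∈ W_n(R). Then there is an R-algebra automorphism of B_{m,n}(R) sending, for each 0 ≤ i < m and 0 ≤ j < n, the generator x_i to the i-th p-typical Witt addition polynomial evaluated at (x_0,…,x_i, a_0,…,a_i) and the generator y_j to the j-th p-typical Witt addition polynomial evaluated at (y_0,…,y_j, b_0,…,b_j) (these evaluations make sense since the x_i pairwise commute and the y_j pairwise commute). In other words, B_{m,n}(R)(x, y) = B_{m,n}(R)(x + a, y + b), where x + a and y + b are sums of truncated p-typical Witt vectors. -/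

import Mathlib

noncomputable section

/-- The product `∏ i, x i ^ e i` over the support of `e`, with factors multiplied in
increasing order of the index. -/
def ordProd {σ M : Type*} [LinearOrder σ] [Monoid M] (x : σ → M) (e : σ →₀ ℕ) : M :=
  ((e.support.sort (· ≤ ·)).map fun i => x i ^ e i).prod

/-- Evaluation of a multivariate polynomial in a (possibly noncommutative) algebra:
each monomial is evaluated as the ordered product of the powers of the substituted
values, the variables being multiplied in increasing order of their (linearly ordered)
index. -/
def pEval {σ R A : Type*} [LinearOrder σ] [CommSemiring R] [Semiring A] [Algebra R A]
    (x : σ → A) (q : MvPolynomial σ R) : A :=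
  q.support.sum fun e => MvPolynomial.coeff e q • ordProd x e

/-- Evaluation of an integral polynomial in the commuting variables `X_d` (`d : ℕ+`, left
summand) and `Y_e` (`e : ℕ+`, right summand), substituting `x d` for `X_d` and `y e` for
`Y_e`; in each monomial all `X`-factors (in increasing index order) are multiplied to the
left of all `Y`-factors (in increasing index order), as appropriate for a polynomial in
`ℤ[X][Y]`. -/
def cEval {A : Type*} [Ring A] (x y : ℕ+ → A) (q : MvPolynomial (ℕ+ ⊕ₗ ℕ+) ℤ) : A :=
  pEval (fun v => Sum.elim x y (ofLex v)) q

/-- The `k`-th ghost value `w_k(g) = ∑_{d ∣ k} d · (g d)^(k/d)`. -/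
def ghost {A : Type*} [Ring A] (g : ℕ+ → A) (k : ℕ+) : A :=
  ∑ d ∈ (k : ℕ).divisors.attach,
    ((d : ℕ) : A) * g ⟨(d : ℕ), Nat.pos_of_mem_divisors d.2⟩ ^ ((k : ℕ) / (d : ℕ))

/-- The generator `x_d` of the free algebra underlying `B(ℚ)`. -/
def bXf (d : ℕ+) : FreeAlgebra ℚ (ℕ+ ⊕ ℕ+) := FreeAlgebra.ι ℚ (Sum.inl d)

/-- The generator `y_e` of the free algebra underlying `B(ℚ)`. -/
def bYf (e : ℕ+) : FreeAlgebra ℚ (ℕ+ ⊕ ℕ+) := FreeAlgebra.ι ℚ (Sum.inr e)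

/-- The defining relations of `B(ℚ)`: `[w_k(x), w_l(x)] = 0`, `[w_k(y), w_l(y)] = 0` and
`[w_l(y), w_k(x)] = δ_{k,l}·k` for all `k, l ≥ 1`. -/
inductive BRel : FreeAlgebra ℚ (ℕ+ ⊕ ℕ+) → FreeAlgebra ℚ (ℕ+ ⊕ ℕ+) → Prop
  | xx (k l : ℕ+) : BRel (ghost bXf k * ghost bXf l) (ghost bXf l * ghost bXf k)
  | yy (k l : ℕ+) : BRel (ghost bYf k * ghost bYf l) (ghost bYf l * ghost bYf k)
  | yx (k l : ℕ+) : BRel (ghost bYf l * ghost bXf k)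
      (ghost bXf k * ghost bYf l + if k = l then ((k : ℕ) : FreeAlgebra ℚ (ℕ+ ⊕ ℕ+)) else 0)

/-- The universal algebra `B(ℚ)`. -/
abbrev BQ : Type := RingQuot BRel

/-- The generator `x_d` of `B(ℚ)`. -/
def bx (d : ℕ+) : BQ := RingQuot.mkAlgHom ℚ BRel (bXf d)

/-- The generator `y_e` of `B(ℚ)`. -/
def by' (e : ℕ+) : BQ := RingQuot.mkAlgHom ℚ BRel (bYf e)

/-- `c` is a family of polynomials `c_{m,n}` as in the paper: `c m n` is an integral
polynomial in the variables `X_d` (`d` a proper divisor of `m`) and `Y_e` (`e` a proper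
divisor of `n`) such that `[y_n, x_m] = c_{m,n}(x, y)` holds in `B(ℚ)`. -/
def IsCFamily (c : ℕ+ → ℕ+ → MvPolynomial (ℕ+ ⊕ₗ ℕ+) ℤ) : Prop :=
  ∀ m n : ℕ+,
    (∀ v ∈ (c m n).vars,
      (∃ d : ℕ+, (d : ℕ) ∣ (m : ℕ) ∧ d ≠ m ∧ ofLex v = Sum.inl d) ∨
      (∃ e : ℕ+, (e : ℕ) ∣ (n : ℕ) ∧ e ≠ n ∧ ofLex v = Sum.inr e)) ∧
    cEval bx by' (c m n) = by' n * bx m - bx m * by' n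


/-- `p ^ i` as a positive natural number. -/
def ppow (p i : ℕ) : ℕ+ := (p ^ i).toPNat'

/-- Substitution of the generators `x_0, …, x_{m-1}` for the variables `X_{p^0}, …, X_{p^{m-1}}`
(the variable `X_{p^r}` is sent to `x_r`). -/
def sxm (R : Type*) [CommRing R] (p m n : ℕ) : ℕ+ → FreeAlgebra R (Fin m ⊕ Fin n) :=
  fun d => if h : padicValNat p (d : ℕ) < m
    then FreeAlgebra.ι R (Sum.inl ⟨padicValNat p (d : ℕ), h⟩) else 0

/-- Substitution of the generators `y_0, …, y_{n-1}` for the variables `Y_{p^0}, …, Y_{p^{n-1}}`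
(the variable `Y_{p^s}` is sent to `y_s`). -/
def syn (R : Type*) [CommRing R] (p m n : ℕ) : ℕ+ → FreeAlgebra R (Fin m ⊕ Fin n) :=
  fun e => if h : padicValNat p (e : ℕ) < n
    then FreeAlgebra.ι R (Sum.inr ⟨padicValNat p (e : ℕ), h⟩) else 0

/-- The defining relations of the truncated `p`-typical algebra `B_{m,n}(R)`:
`[x_i, x_{i'}] = 0`, `[y_j, y_{j'}] = 0` and
`[y_j, x_i] = c_{p^i, p^j}(x_0, …, x_{i-1}, y_0, …, y_{j-1})`. -/
inductive BmnRel (R : Type*) [CommRing R] (p : ℕ)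
    (c : ℕ+ → ℕ+ → MvPolynomial (ℕ+ ⊕ₗ ℕ+) ℤ) (m n : ℕ) :
    FreeAlgebra R (Fin m ⊕ Fin n) → FreeAlgebra R (Fin m ⊕ Fin n) → Prop
  | xx (i i' : Fin m) : BmnRel R p c m n
      (FreeAlgebra.ι R (Sum.inl i) * FreeAlgebra.ι R (Sum.inl i'))
      (FreeAlgebra.ι R (Sum.inl i') * FreeAlgebra.ι R (Sum.inl i))
  | yy (j j' : Fin n) : BmnRel R p c m n
      (FreeAlgebra.ι R (Sum.inr j) * FreeAlgebra.ι R (Sum.inr j'))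
      (FreeAlgebra.ι R (Sum.inr j') * FreeAlgebra.ι R (Sum.inr j))
  | yx (i : Fin m) (j : Fin n) : BmnRel R p c m n
      (FreeAlgebra.ι R (Sum.inr j) * FreeAlgebra.ι R (Sum.inl i))
      (FreeAlgebra.ι R (Sum.inl i) * FreeAlgebra.ι R (Sum.inr j) +
        cEval (sxm R p m n) (syn R p m n) (c (ppow p (i : ℕ)) (ppow p (j : ℕ))))

/-- The truncated `p`-typical algebra `B_{m,n}(R)`. -/
abbrev Bmn (R : Type*) [CommRing R] (p : ℕ) (c : ℕ+ → ℕ+ → MvPolynomial (ℕ+ ⊕ₗ ℕ+) ℤ)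
    (m n : ℕ) : Type _ := RingQuot (BmnRel R p c m n)

/-- The generator `x_i` of `B_{m,n}(R)`. -/
def gx (R : Type*) [CommRing R] (p : ℕ) (c : ℕ+ → ℕ+ → MvPolynomial (ℕ+ ⊕ₗ ℕ+) ℤ)
    (m n : ℕ) (i : Fin m) : Bmn R p c m n :=
  RingQuot.mkAlgHom R (BmnRel R p c m n) (FreeAlgebra.ι R (Sum.inl i))

/-- The generator `y_j` of `B_{m,n}(R)`. -/
def gy (R : Type*) [CommRing R] (p : ℕ) (c : ℕ+ → ℕ+ → MvPolynomial (ℕ+ ⊕ₗ ℕ+) ℤ)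
    (m n : ℕ) (j : Fin n) : Bmn R p c m n :=
  RingQuot.mkAlgHom R (BmnRel R p c m n) (FreeAlgebra.ι R (Sum.inr j))

/-- Substitution used to express the Witt-vector sum `x + a` inside `B_{m,n}(R)`: the
variable of index `(0, k)` (for `k < m`) is sent to the generator `x_k` and the variable of
index `(1, k)` (for `k < m`) is sent to the scalar `a_k`. -/
def addSubstX (R : Type*) [CommRing R] (p : ℕ) (c : ℕ+ → ℕ+ → MvPolynomial (ℕ+ ⊕ₗ ℕ+) ℤ)
    (m n : ℕ) (a : TruncatedWittVector p m R) : Fin 2 ×ₗ ℕ → Bmn R p c m n :=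
  fun v =>
    if (ofLex v).1 = 0 then
      (if h : (ofLex v).2 < m then gx R p c m n ⟨(ofLex v).2, h⟩ else 0)
    else
      (if h : (ofLex v).2 < m then algebraMap R (Bmn R p c m n) (a.coeff ⟨(ofLex v).2, h⟩)
       else 0)

/-- Substitution used to express the Witt-vector sum `y + b` inside `B_{m,n}(R)`: the
variable of index `(0, k)` (for `k < n`) is sent to the generator `y_k` and the variable of
index `(1, k)` (for `k < n`) is sent to the scalar `b_k`. -/
def addSubstY (R : Type*) [CommRing R] (p : ℕ) (c : ℕ+ → ℕ+ → MvPolynomial (ℕ+ ⊕ₗ ℕ+) ℤ)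
    (m n : ℕ) (b : TruncatedWittVector p n R) : Fin 2 ×ₗ ℕ → Bmn R p c m n :=
  fun v =>
    if (ofLex v).1 = 0 then
      (if h : (ofLex v).2 < n then gy R p c m n ⟨(ofLex v).2, h⟩ else 0)
    else
      (if h : (ofLex v).2 < n then algebraMap R (Bmn R p c m n) (b.coeff ⟨(ofLex v).2, h⟩)
       else 0)

theorem ordProd_eq_prod {σ A : Type*} [LinearOrder σ] [CommMonoid A] (x : σ → A)
    (e : σ →₀ ℕ) : ordProd x e = e.prod fun i k => x i ^ k := by
  rw [ordProd, ← Multiset.prod_coe, ← Multiset.map_coe, Finset.sort_eq]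
  rfl

theorem map_ordProd {σ A B : Type*} [LinearOrder σ] [Monoid A] [Monoid B] (f : A →* B)
    (x : σ → A) (e : σ →₀ ℕ) : f (ordProd x e) = ordProd (fun i => f (x i)) e := by
  simp [ordProd, map_list_prod, Function.comp_def]

theorem map_pEval {σ A B : Type*} [LinearOrder σ] [Ring A] [Ring B] [Algebra ℤ A] [Algebra ℤ B]
    (f : A →+* B) (x : σ → A) (q : MvPolynomial σ ℤ) :
    f (pEval x q) = pEval (fun i => f (x i)) q := by
  simp only [pEval, map_sum, Algebra.smul_def, map_mul, eq_intCast, map_intCast]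
  refine Finset.sum_congr rfl fun e _ => ?_
  exact congrArg _ (map_ordProd (f : A →* B) x e)

theorem pEval_eq_aeval {σ A : Type*} [LinearOrder σ] [CommRing A] (x : σ → A)
    (q : MvPolynomial σ ℤ) : pEval x q = MvPolynomial.aeval x q := by
  rw [MvPolynomial.aeval_def, MvPolynomial.eval₂_eq]
  simp only [pEval, Algebra.smul_def, ordProd_eq_prod]
  rfl

theorem pEval_comp {σ A C : Type*} [LinearOrder σ] [Ring A] [Algebra ℤ A] [CommRing C]
    (f : C →+* A) (x : σ → C) (q : MvPolynomial σ ℤ) :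
    pEval (fun i => f (x i)) q = f (MvPolynomial.aeval x q) := by
  rw [← map_pEval, pEval_eq_aeval]

theorem pEval_congr {σ A : Type*} [LinearOrder σ] [Ring A] [Algebra ℤ A] {x y : σ → A}
    {q : MvPolynomial σ ℤ} (h : ∀ v ∈ q.vars, x v = y v) : pEval x q = pEval y q := by
  refine Finset.sum_congr rfl fun e he => ?_
  congr 1
  unfold ordProd
  congr 1
  refine List.map_congr_left fun i hi => ?_
  rw [h i ((MvPolynomial.mem_vars_iff_mem_support i).2 ⟨e, he, by simpa using hi⟩)]

theorem pEval_mem {σ S A : Type*} [LinearOrder σ] [CommRing S] [Ring A] [Algebra ℤ A]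
    [Algebra S A] (N : Subalgebra S A) {x : σ → A}
    {q : MvPolynomial σ ℤ} (h : ∀ v ∈ q.vars, x v ∈ N) : pEval x q ∈ N := by
  refine sum_mem fun e he => ?_
  rw [Algebra.smul_def, eq_intCast]
  refine mul_mem (intCast_mem N _) (list_prod_mem fun a ha => ?_)
  obtain ⟨i, hi, rfl⟩ := List.mem_map.1 ha
  exact pow_mem (h i ((MvPolynomial.mem_vars_iff_mem_support i).2 ⟨e, he, by simpa using hi⟩)) _

theorem map_cEval {A B : Type*} [Ring A] [Ring B] (f : A →+* B) (x y : ℕ+ → A)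
    (q : MvPolynomial (ℕ+ ⊕ₗ ℕ+) ℤ) :
    f (cEval x y q) = cEval (fun d => f (x d)) (fun e => f (y e)) q := by
  rw [cEval, map_pEval, cEval]
  congr 1
  funext v
  cases ofLex v <;> rfl

theorem map_ghost {A B : Type*} [Ring A] [Ring B] (f : A →+* B) (g : ℕ+ → A) (k : ℕ+) :
    f (ghost g k) = ghost (fun d => f (g d)) k := by
  simp [ghost]

/-- The algebra homomorphism out of a polynomial ring determined by a commuting family. -/
theorem exists_algHom_of_commute {σ S A : Type*} [CommRing S] [Ring A] [Algebra S A]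
    (x : σ → A) (h : ∀ i j, x i * x j = x j * x i) :
    ∃ φ : MvPolynomial σ S →ₐ[S] A, ∀ i, φ (MvPolynomial.X i) = x i := by
  have hcomm : IsMulCommutative (Algebra.adjoin S (Set.range x)) :=
    Algebra.isMulCommutative_adjoin S (by rintro _ ⟨i, rfl⟩ _ ⟨j, rfl⟩; exact h i j)
  let _ : CommRing (Algebra.adjoin S (Set.range x)) :=
    { (inferInstance : Ring (Algebra.adjoin S (Set.range x))) with
      mul_comm := hcomm.is_comm.comm }
  refine ⟨(Algebra.adjoin S (Set.range x)).val.comp (MvPolynomial.aeval fun i =>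
    ⟨x i, Algebra.subset_adjoin ⟨i, rfl⟩⟩), fun i => ?_⟩
  simp

/-- Any pair of families whose ghost values satisfy the Weyl relations satisfies the
commutation rule described by `c`. -/
theorem cEval_of_ghost {c : ℕ+ → ℕ+ → MvPolynomial (ℕ+ ⊕ₗ ℕ+) ℤ} (hc : IsCFamily c)
    {A : Type*} [Ring A] [Algebra ℚ A] (x y : ℕ+ → A)
    (hxx : ∀ k l, ghost x k * ghost x l = ghost x l * ghost x k)
    (hyy : ∀ k l, ghost y k * ghost y l = ghost y l * ghost y k)
    (hyx : ∀ k l, ghost y l * ghost x k =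
      ghost x k * ghost y l + if k = l then ((k : ℕ) : A) else 0) (k l : ℕ+) :
    cEval x y (c k l) = y l * x k - x k * y l := by
  let F : FreeAlgebra ℚ (ℕ+ ⊕ ℕ+) →ₐ[ℚ] A := FreeAlgebra.lift ℚ (Sum.elim x y)
  have hx : ∀ d, F (bXf d) = x d := fun d => by simp [F, bXf]
  have hy : ∀ d, F (bYf d) = y d := fun d => by simp [F, bYf]
  have gX : ∀ k, F (ghost bXf k) = ghost x k := fun k =>
    (map_ghost F.toRingHom _ k).trans (congrArg (ghost · k) (funext hx))
  have gY : ∀ k, F (ghost bYf k) = ghost y k := fun k =>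
    (map_ghost F.toRingHom _ k).trans (congrArg (ghost · k) (funext hy))
  let G : BQ →ₐ[ℚ] A := RingQuot.liftAlgHom ℚ ⟨F, by
    rintro _ _ (⟨k, l⟩ | ⟨k, l⟩ | ⟨k, l⟩)
    · simp only [map_mul, gX, hxx k l]
    · simp only [map_mul, gY, hyy k l]
    · simp only [map_mul, map_add, gX, gY, hyx k l]
      split_ifs <;> simp⟩
  have hGx : ∀ d, G (bx d) = x d := fun d => by
    rw [← hx d]; exact RingQuot.liftAlgHom_mkAlgHom_apply ..
  have hGy : ∀ d, G (by' d) = y d := fun d => by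
    rw [← hy d]; exact RingQuot.liftAlgHom_mkAlgHom_apply ..
  have := congrArg G.toRingHom (hc k l).2
  rw [map_cEval] at this
  simpa [hGx, hGy] using this

/-- The family with prescribed ghost values over a `ℚ`-algebra. -/
def ghostInv {A : Type*} [CommRing A] [Algebra ℚ A] (t : ℕ+ → A) (k : ℕ+) : A :=
  ((k : ℕ) : ℚ)⁻¹ • (t k - ∑ d ∈ (k : ℕ).properDivisors.attach, ((d : ℕ) : A) *
    ghostInv t ⟨(d : ℕ), Nat.pos_of_mem_properDivisors d.2⟩ ^ ((k : ℕ) / (d : ℕ)))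
termination_by (k : ℕ)
decreasing_by exact (Nat.mem_properDivisors.1 d.2).2

theorem ghost_eq_sum {A : Type*} [Ring A] (g : ℕ+ → A) (k : ℕ+) :
    ghost g k = ∑ d ∈ (k : ℕ).divisors, (d : A) * g d.toPNat' ^ ((k : ℕ) / d) := by
  rw [ghost, ← Finset.sum_attach (k : ℕ).divisors]
  refine Finset.sum_congr rfl fun d _ => ?_
  congr 3
  exact PNat.eq (by simp [Nat.toPNat'_coe, Nat.pos_of_mem_divisors d.2])

theorem ghost_ghostInv {A : Type*} [CommRing A] [Algebra ℚ A] (t : ℕ+ → A) (k : ℕ+) :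
    ghost (ghostInv t) k = t k := by
  have h : ∑ d ∈ (k : ℕ).properDivisors.attach, ((d : ℕ) : A) *
      ghostInv t ⟨(d : ℕ), Nat.pos_of_mem_properDivisors d.2⟩ ^ ((k : ℕ) / (d : ℕ)) =
      ∑ d ∈ (k : ℕ).properDivisors, (d : A) * ghostInv t d.toPNat' ^ ((k : ℕ) / d) := by
    rw [← Finset.sum_attach (k : ℕ).properDivisors]
    refine Finset.sum_congr rfl fun d _ => ?_
    congr 3
    exact PNat.eq (by simp [Nat.toPNat'_coe, Nat.pos_of_mem_properDivisors d.2])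
  have hk : ((k : ℕ) : ℚ) ≠ 0 := by simp
  rw [ghost_eq_sum, ← Nat.insert_self_properDivisors k.ne_zero,
    Finset.sum_insert Nat.self_notMem_properDivisors, Nat.div_self k.pos, pow_one,
    PNat.coe_toPNat', ghostInv, h, Algebra.smul_def, ← mul_assoc,
    ← map_natCast (algebraMap ℚ A), ← map_mul, mul_inv_cancel₀ hk, map_one, one_mul,
    sub_add_cancel]

theorem coe_ppow (p : ℕ) [hp : Fact p.Prime] (i : ℕ) : (ppow p i : ℕ) = p ^ i := by
  simp [ppow, Nat.toPNat'_coe, hp.out.pos]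

theorem padicValNat_ppow (p : ℕ) [hp : Fact p.Prime] (i : ℕ) :
    padicValNat p (ppow p i) = i := by
  rw [coe_ppow, padicValNat.prime_pow]

theorem eq_ppow_of_dvd (p : ℕ) [hp : Fact p.Prime] {d : ℕ+} {i : ℕ}
    (h : (d : ℕ) ∣ ppow p i) : d = ppow p (padicValNat p d) ∧ padicValNat p d ≤ i := by
  rw [coe_ppow] at h
  obtain ⟨k, hk, hd⟩ := (Nat.dvd_prime_pow hp.out).1 h
  rw [hd, padicValNat.prime_pow]
  exact ⟨PNat.eq (by rw [hd, coe_ppow]), hk⟩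

theorem ghost_ppow (p : ℕ) [hp : Fact p.Prime] {A : Type*} [CommRing A] (g : ℕ+ → A) (i : ℕ) :
    ghost g (ppow p i) =
      WittVector.ghostComponent i (WittVector.mk p fun j => g (ppow p j)) := by
  rw [WittVector.ghostComponent_apply, aeval_wittPolynomial, ghost_eq_sum, coe_ppow,
    Nat.divisors_prime_pow hp.out, Finset.sum_map]
  refine Finset.sum_congr rfl fun j hj => ?_
  have : j ≤ i := by simpa [Nat.lt_succ_iff] using hj
  simp [Nat.pow_div this hp.out.pos, ppow]

theorem ghostComponent_injective (p : ℕ) [hp : Fact p.Prime] {A : Type*} [CommRing A]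
    [Algebra ℚ A] {u v : WittVector p A}
    (h : ∀ i, WittVector.ghostComponent i u = WittVector.ghostComponent i v) : u = v := by
  let _ : Invertible (p : ℚ) := invertibleOfNonzero (by exact_mod_cast hp.out.ne_zero)
  let _ : Invertible (p : A) := by
    have := Invertible.map (algebraMap ℚ A) (p : ℚ)
    rwa [map_natCast] at this
  exact (WittVector.ghostMap.bijective_of_invertible p A).1 (funext h)

/-- The family indexed by `ℕ+` whose value at `p ^ r` is `x r`. -/
def padicExtend (p : ℕ) {A : Type*} [Zero A] {m : ℕ} (x : Fin m → A) (d : ℕ+) : A :=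
  if h : padicValNat p d < m then x ⟨padicValNat p d, h⟩ else 0

/-- The components of the Witt vector sum `x + a`, for `a` a Witt vector of scalars. -/
def wittShift {p : ℕ} [Fact p.Prime] {S A : Type*} [CommRing S] [Ring A] [Algebra S A] {m : ℕ}
    (x : Fin m → A) (a : WittVector p S) (i : ℕ) : A :=
  pEval (fun v : Fin 2 ×ₗ ℕ =>
    if (ofLex v).1 = 0 then (if h : (ofLex v).2 < m then x ⟨(ofLex v).2, h⟩ else 0)
    else algebraMap S A (a.coeff (ofLex v).2))
    (MvPolynomial.rename (toLex : Fin 2 × ℕ → Fin 2 ×ₗ ℕ) (WittVector.wittAdd p i))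

theorem witt_add_coeff_congr {p : ℕ} [Fact p.Prime] {C : Type*} [CommRing C] {m : ℕ}
    {u v : WittVector p C} (h : ∀ k < m, u.coeff k = v.coeff k) (w : WittVector p C)
    {i : ℕ} (hi : i < m) : (u + w).coeff i = (v + w).coeff i := by
  have huv : WittVector.truncate m u = WittVector.truncate m v := by
    ext k
    simp [h k k.2]
  have := congrArg (fun t => TruncatedWittVector.coeff ⟨i, hi⟩ (t + WittVector.truncate m w)) huv
  simpa only [← map_add, WittVector.coeff_truncate] using this

theorem wittShift_eq {p : ℕ} [Fact p.Prime] {S A C : Type*} [CommRing S] [Ring A] [Algebra S A]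
    [CommRing C] {m : ℕ} {x : Fin m → A} {a : WittVector p S} (φ : C →+* A)
    (X a' : WittVector p C) (hX : ∀ k : Fin m, φ (X.coeff k) = x k)
    (ha : ∀ k, φ (a'.coeff k) = algebraMap S A (a.coeff k)) {i : ℕ} (hi : i < m) :
    wittShift x a i = φ ((X + a').coeff i) := by
  let X' : WittVector p C := WittVector.mk p fun k => if k < m then X.coeff k else 0
  have hX' : (X + a').coeff i = (X' + a').coeff i :=
    witt_add_coeff_congr (fun k hk => by simp [X', hk]) a' hi
  rw [hX', WittVector.add_coeff, WittVector.peval, wittShift]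
  have := pEval_comp φ (fun v : Fin 2 ×ₗ ℕ => Function.uncurry ![X'.coeff, a'.coeff] (ofLex v))
    (MvPolynomial.rename (toLex : Fin 2 × ℕ → Fin 2 ×ₗ ℕ) (WittVector.wittAdd p i))
  rw [MvPolynomial.aeval_rename] at this
  refine Eq.trans ?_ this
  congr 1
  funext v
  obtain ⟨⟨s, k⟩, rfl⟩ := toLex.surjective v
  fin_cases s
  · by_cases hk : k < m
    · simpa [X', hk] using (hX ⟨k, hk⟩).symm
    · simp [X', hk]
  · simpa using (ha k).symm

theorem map_wittShift {p : ℕ} [Fact p.Prime] {S T A B : Type*} [CommRing S] [CommRing T] [Ring A]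
    [Algebra S A] [Ring B] [Algebra T B] {m : ℕ} (f : A →+* B) (x : Fin m → A)
    (a : WittVector p S) (b : WittVector p T)
    (h : ∀ k, f (algebraMap S A (a.coeff k)) = algebraMap T B (b.coeff k)) (i : ℕ) :
    f (wittShift x a i) = wittShift (fun k => f (x k)) b i := by
  rw [wittShift, map_pEval, wittShift]
  congr 1
  funext v
  split_ifs <;> simp [h]

theorem wittShift_eq_of_commute {p : ℕ} [Fact p.Prime] {S A : Type*} [CommRing S] [Ring A]
    [Algebra S A] {m : ℕ} (x : Fin m → A) (h : ∀ i j, x i * x j = x j * x i) :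
    ∃ (φ : MvPolynomial (Fin m) S →ₐ[S] A) (X : WittVector p (MvPolynomial (Fin m) S)),
      (∀ k : Fin m, φ (X.coeff k) = x k) ∧ ∀ (a : WittVector p S) (i : ℕ), i < m →
        wittShift x a i = φ ((X + WittVector.map MvPolynomial.C a).coeff i) := by
  obtain ⟨φ, hφ⟩ := exists_algHom_of_commute (S := S) x h
  have hX : ∀ k : Fin m, φ ((WittVector.mk p fun k => if hk : k < m then MvPolynomial.X ⟨k, hk⟩
      else 0 : WittVector p (MvPolynomial (Fin m) S)).coeff k) = x k := fun k => by simp [hφ]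
  exact ⟨φ, _, hX, fun a i hi => wittShift_eq φ.toRingHom _ _ hX
    (fun k => by simp [WittVector.map_coeff, ← MvPolynomial.algebraMap_eq]) hi⟩

theorem wittShift_commute {p : ℕ} [Fact p.Prime] {S A : Type*} [CommRing S] [Ring A]
    [Algebra S A] {m : ℕ} {x : Fin m → A} (h : ∀ i j, x i * x j = x j * x i)
    (a : WittVector p S) {i j : ℕ} (hi : i < m) (hj : j < m) :
    wittShift x a i * wittShift x a j = wittShift x a j * wittShift x a i := by
  obtain ⟨φ, X, -, hφ⟩ := wittShift_eq_of_commute (p := p) (S := S) x h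
  rw [hφ a i hi, hφ a j hj, ← map_mul, mul_comm, map_mul]

theorem wittShift_neg_cancel {p : ℕ} [Fact p.Prime] {S A : Type*} [CommRing S] [Ring A]
    [Algebra S A] {m : ℕ} {x : Fin m → A} (h : ∀ i j, x i * x j = x j * x i)
    (a : WittVector p S) (i : Fin m) :
    wittShift (fun k : Fin m => wittShift x (-a) k) a i = x i := by
  obtain ⟨φ, X, hX, hφ⟩ := wittShift_eq_of_commute (p := p) (S := S) x h
  rw [wittShift_eq φ.toRingHom (X + WittVector.map MvPolynomial.C (-a))
    (WittVector.map MvPolynomial.C a) (fun k => (hφ (-a) k k.2).symm)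
    (fun k => by simp [WittVector.map_coeff, ← MvPolynomial.algebraMap_eq]) i.2, map_neg,
    neg_add_cancel_right]
  exact hX i

section Presentation

variable {S : Type*} [CommRing S] {p : ℕ} {c : ℕ+ → ℕ+ → MvPolynomial (ℕ+ ⊕ₗ ℕ+) ℤ} {m n : ℕ}

theorem gx_commute (i i' : Fin m) :
    gx S p c m n i * gx S p c m n i' = gx S p c m n i' * gx S p c m n i := by
  simpa [gx] using RingQuot.mkAlgHom_rel S (BmnRel.xx (R := S) (p := p) (c := c) (n := n) i i')

theorem gy_commute (j j' : Fin n) :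
    gy S p c m n j * gy S p c m n j' = gy S p c m n j' * gy S p c m n j := by
  simpa [gy] using RingQuot.mkAlgHom_rel S (BmnRel.yy (R := S) (p := p) (c := c) (m := m) j j')

theorem map_sxm {A : Type*} [Ring A] [Algebra S A] (f : FreeAlgebra S (Fin m ⊕ Fin n) →ₐ[S] A) :
    (fun d => f (sxm S p m n d)) =
      padicExtend p fun i => f (FreeAlgebra.ι S (Sum.inl i)) := by
  funext d
  rw [sxm, padicExtend]
  split_ifs <;> simp

theorem map_syn {A : Type*} [Ring A] [Algebra S A] (f : FreeAlgebra S (Fin m ⊕ Fin n) →ₐ[S] A) :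
    (fun d => f (syn S p m n d)) =
      padicExtend p fun i => f (FreeAlgebra.ι S (Sum.inr i)) := by
  funext d
  rw [syn, padicExtend]
  split_ifs <;> simp

theorem map_cEval_free {A : Type*} [Ring A] [Algebra S A]
    (f : FreeAlgebra S (Fin m ⊕ Fin n) →ₐ[S] A) (q : MvPolynomial (ℕ+ ⊕ₗ ℕ+) ℤ) :
    f (cEval (sxm S p m n) (syn S p m n) q) =
      cEval (padicExtend p fun i => f (FreeAlgebra.ι S (Sum.inl i)))
        (padicExtend p fun i => f (FreeAlgebra.ι S (Sum.inr i))) q := by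
  rw [← map_sxm f, ← map_syn f]
  exact map_cEval f.toRingHom _ _ _

theorem gy_mul_gx (i : Fin m) (j : Fin n) :
    gy S p c m n j * gx S p c m n i = gx S p c m n i * gy S p c m n j +
      cEval (padicExtend p (gx S p c m n)) (padicExtend p (gy S p c m n))
        (c (ppow p i) (ppow p j)) := by
  have := RingQuot.mkAlgHom_rel S (BmnRel.yx (R := S) (p := p) (c := c) i j)
  rw [map_add, map_cEval_free, map_mul, map_mul] at this
  exact this

theorem exists_bmn_lift {A : Type*} [Ring A] [Algebra S A] (x : Fin m → A) (y : Fin n → A)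
    (hxx : ∀ i i', x i * x i' = x i' * x i) (hyy : ∀ j j', y j * y j' = y j' * y j)
    (hyx : ∀ i j, y j * x i = x i * y j +
      cEval (padicExtend p x) (padicExtend p y) (c (ppow p i) (ppow p j))) :
    ∃ f : Bmn S p c m n →ₐ[S] A,
      (∀ i, f (gx S p c m n i) = x i) ∧ ∀ j, f (gy S p c m n j) = y j := by
  let F : FreeAlgebra S (Fin m ⊕ Fin n) →ₐ[S] A := FreeAlgebra.lift S (Sum.elim x y)
  have hx : ∀ i, F (FreeAlgebra.ι S (Sum.inl i)) = x i := fun i => by simp [F]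
  have hy : ∀ j, F (FreeAlgebra.ι S (Sum.inr j)) = y j := fun j => by simp [F]
  refine ⟨RingQuot.liftAlgHom S ⟨F, ?_⟩,
    fun i => (RingQuot.liftAlgHom_mkAlgHom_apply ..).trans (hx i),
    fun j => (RingQuot.liftAlgHom_mkAlgHom_apply ..).trans (hy j)⟩
  rintro _ _ (⟨i, i'⟩ | ⟨j, j'⟩ | ⟨i, j⟩)
  · simp only [map_mul, hx, hxx i i']
  · simp only [map_mul, hy, hyy j j']
  · rw [map_add, map_cEval_free]
    simp only [map_mul, hx, hy, hyx i j]

theorem bmn_adjoin_eq_top :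
    Algebra.adjoin S (Set.range (gx S p c m n) ∪ Set.range (gy S p c m n)) = ⊤ := by
  rw [eq_top_iff]
  rintro z -
  obtain ⟨w, rfl⟩ := RingQuot.mkAlgHom_surjective S (BmnRel S p c m n) z
  induction w using FreeAlgebra.induction with
  | grade0 r => simp
  | grade1 v =>
    apply Algebra.subset_adjoin
    cases v with
    | inl i => exact Or.inl ⟨i, rfl⟩
    | inr j => exact Or.inr ⟨j, rfl⟩
  | mul a b ha hb => rw [map_mul]; exact mul_mem ha hb
  | add a b ha hb => rw [map_add]; exact add_mem ha hb

end Presentation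

section NormalOrdering

variable {S A : Type*} [CommRing S] [Ring A] [Algebra S A]

theorem sup_le_mul_of_mul_le {X Y : Subalgebra S A}
    (h : Subalgebra.toSubmodule Y * Subalgebra.toSubmodule X ≤
      Subalgebra.toSubmodule X * Subalgebra.toSubmodule Y) :
    Subalgebra.toSubmodule (X ⊔ Y) ≤ Subalgebra.toSubmodule X * Subalgebra.toSubmodule Y := by
  set M := Subalgebra.toSubmodule X * Subalgebra.toSubmodule Y with hM
  have hMM : M * M ≤ M := calc
    M * M = Subalgebra.toSubmodule X * (Subalgebra.toSubmodule Y * Subalgebra.toSubmodule X) *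
        Subalgebra.toSubmodule Y := by simp only [hM, mul_assoc]
    _ ≤ Subalgebra.toSubmodule X * M * Subalgebra.toSubmodule Y := by gcongr
    _ = (Subalgebra.toSubmodule X * Subalgebra.toSubmodule X) *
        (Subalgebra.toSubmodule Y * Subalgebra.toSubmodule Y) := by simp only [hM, mul_assoc]
    _ = M := by rw [(Subalgebra.isIdempotentElem_toSubmodule X).eq,
        (Subalgebra.isIdempotentElem_toSubmodule Y).eq]
  have hXM : ∀ a ∈ X, a ∈ M := fun a ha => by
    simpa using Submodule.mul_mem_mul (M := Subalgebra.toSubmodule X)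
      (N := Subalgebra.toSubmodule Y) ha (one_mem Y)
  have hYM : ∀ a ∈ Y, a ∈ M := fun a ha => by
    simpa using Submodule.mul_mem_mul (M := Subalgebra.toSubmodule X)
      (N := Subalgebra.toSubmodule Y) (one_mem X) ha
  let T : Subalgebra S A := M.toSubalgebra (hXM 1 (one_mem X))
    fun a b ha hb => hMM (Submodule.mul_mem_mul ha hb)
  have : X ⊔ Y ≤ T := sup_le hXM hYM
  exact this

theorem adjoin_mul_adjoin_le {m n : ℕ} (x : Fin m → A) (y : Fin n → A)
    (h : ∀ i j, y j * x i - x i * y j ∈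
      Algebra.adjoin S (Set.range x) ⊔ Algebra.adjoin S (y '' {k | k < j})) (j : ℕ) :
    Subalgebra.toSubmodule (Algebra.adjoin S (y '' {k | (k : ℕ) < j})) *
        Subalgebra.toSubmodule (Algebra.adjoin S (Set.range x)) ≤
      Subalgebra.toSubmodule (Algebra.adjoin S (Set.range x)) *
        Subalgebra.toSubmodule (Algebra.adjoin S (y '' {k | (k : ℕ) < j})) := by
  set X := Algebra.adjoin S (Set.range x)
  induction j with
  | zero => simp [Algebra.toSubmodule_bot]
  | succ j ih =>
    set Y := Algebra.adjoin S (y '' {k | (k : ℕ) < j}) with hY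
    set Y' := Algebra.adjoin S (y '' {k | (k : ℕ) < j + 1})
    have hYY' : Y ≤ Y' := Algebra.adjoin_mono (Set.image_mono fun k hk => Nat.lt_succ_of_lt hk)
    have hXYY' : Subalgebra.toSubmodule X * Subalgebra.toSubmodule Y * Subalgebra.toSubmodule Y' ≤
        Subalgebra.toSubmodule X * Subalgebra.toSubmodule Y' := by
      rw [mul_assoc]
      refine mul_le_mul_right ?_ _
      calc _ ≤ Subalgebra.toSubmodule Y' * Subalgebra.toSubmodule Y' := by gcongr
        _ = _ := (Subalgebra.isIdempotentElem_toSubmodule Y').eq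
    have key : ∀ a ∈ Y', ∀ z ∈ Subalgebra.toSubmodule X * Subalgebra.toSubmodule Y',
        a * z ∈ Subalgebra.toSubmodule X * Subalgebra.toSubmodule Y' := by
      intro a ha
      induction ha using Algebra.adjoin_induction with
      | mem a ha =>
        obtain ⟨k, hk, rfl⟩ := ha
        intro z hz
        induction hz using Submodule.mul_induction_on' with
        | add u _ v _ hu hv => rw [mul_add]; exact add_mem hu hv
        | mem_mul_mem f hf g hg =>
          obtain hk | hk := Nat.lt_succ_iff_lt_or_eq.1 hk
          · rw [← mul_assoc]
            exact hXYY' (Submodule.mul_mem_mul (ih (Submodule.mul_mem_mul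
              (Algebra.subset_adjoin ⟨k, hk, rfl⟩) hf)) hg)
          · have hcomm : y k * f - f * y k ∈ X ⊔ Y := by
              clear hg
              induction hf using Algebra.adjoin_induction with
              | mem f hf =>
                obtain ⟨i, rfl⟩ := hf
                simpa only [hY, ← hk, Fin.val_fin_lt] using h i k
              | algebraMap r => simp [Algebra.commutes]
              | add f f' _ _ hf hf' =>
                rw [mul_add, add_mul, add_sub_add_comm]
                exact add_mem hf hf'
              | mul f f' h1 h2 hf hf' =>
                rw [show y k * (f * f') - f * f' * y k =
                  (y k * f - f * y k) * f' + f * (y k * f' - f' * y k) by noncomm_ring]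
                exact add_mem (mul_mem hf (le_sup_left (a := X) h2))
                  (mul_mem (le_sup_left (a := X) h1) hf')
            rw [show y k * (f * g) = f * (y k * g) + (y k * f - f * y k) * g by noncomm_ring]
            refine add_mem (Submodule.mul_mem_mul hf
              (mul_mem (S := Subalgebra S A) (s := Y')
                (Algebra.subset_adjoin ⟨k, by simp [hk], rfl⟩) hg)) (hXYY' ?_)
            exact Submodule.mul_mem_mul (sup_le_mul_of_mul_le ih hcomm) hg
      | algebraMap r =>
        intro z hz
        rw [← Algebra.smul_def]
        exact Submodule.smul_mem _ r hz
      | add a b _ _ ha hb => exact fun z hz => by rw [add_mul]; exact add_mem (ha z hz) (hb z hz)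
      | mul a b _ _ ha hb => exact fun z hz => by rw [mul_assoc]; exact ha _ (hb z hz)
    rw [Submodule.mul_le]
    intro a ha f hf
    refine key a ha f ?_
    simpa using Submodule.mul_mem_mul (N := Subalgebra.toSubmodule Y') hf (one_mem Y')

end NormalOrdering

theorem bmn_commutator_mem {S : Type*} [CommRing S] {p : ℕ} [hp : Fact p.Prime]
    {c : ℕ+ → ℕ+ → MvPolynomial (ℕ+ ⊕ₗ ℕ+) ℤ} (hc : IsCFamily c) {m n : ℕ}
    (i : Fin m) (j : Fin n) :
    gy S p c m n j * gx S p c m n i - gx S p c m n i * gy S p c m n j ∈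
      Algebra.adjoin S (Set.range (gx S p c m n)) ⊔
        Algebra.adjoin S (gy S p c m n '' {k | k < j}) := by
  rw [gy_mul_gx, add_sub_cancel_left]
  refine pEval_mem _ fun v hv => ?_
  obtain ⟨d, -, -, hd⟩ | ⟨e, hdvd, hne, he⟩ := (hc _ _).1 v hv
  · rw [hd, Sum.elim_inl, padicExtend]
    split_ifs with h
    · exact le_sup_left (α := Subalgebra S _) (Algebra.subset_adjoin ⟨_, rfl⟩)
    · exact zero_mem _
  · rw [he, Sum.elim_inr, padicExtend]
    split_ifs with h
    · obtain ⟨h1, h2⟩ := eq_ppow_of_dvd p hdvd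
      refine le_sup_right (α := Subalgebra S _) (Algebra.subset_adjoin ⟨_, ?_, rfl⟩)
      refine lt_of_le_of_ne h2 fun h3 => hne ?_
      rw [h1]
      exact congrArg _ h3
    · exact zero_mem _

/-- The normally ordered products span `B_{m,n}(S)`. -/
theorem bmn_normal_ordering {S : Type*} [CommRing S] {p : ℕ} [hp : Fact p.Prime]
    {c : ℕ+ → ℕ+ → MvPolynomial (ℕ+ ⊕ₗ ℕ+) ℤ} (hc : IsCFamily c) (m n : ℕ) :
    Subalgebra.toSubmodule (Algebra.adjoin S (Set.range (gx S p c m n))) *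
      Subalgebra.toSubmodule (Algebra.adjoin S (Set.range (gy S p c m n))) = ⊤ := by
  have h := adjoin_mul_adjoin_le (S := S) (gx S p c m n) (gy S p c m n)
    (bmn_commutator_mem hc) n
  have hn : (gy S p c m n '' {k | (k : ℕ) < n}) = Set.range (gy S p c m n) := by
    simp
  rw [hn] at h
  have := sup_le_mul_of_mul_le h
  rw [← Algebra.adjoin_union, bmn_adjoin_eq_top, Algebra.top_toSubmodule] at this
  exact top_le_iff.1 this

/-- A linear map sending each monomial to the corresponding normally ordered product exists
and is surjective. -/
theorem exists_normal_ordering_map {S : Type*} [CommRing S] {p : ℕ} [hp : Fact p.Prime]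
    {c : ℕ+ → ℕ+ → MvPolynomial (ℕ+ ⊕ₗ ℕ+) ℤ} (hc : IsCFamily c) (m n : ℕ) :
    ∃ (φ : MvPolynomial (Fin m) S →ₐ[S] Bmn S p c m n)
      (ψ : MvPolynomial (Fin n) S →ₐ[S] Bmn S p c m n)
      (N : MvPolynomial (Fin m ⊕ Fin n) S →ₗ[S] Bmn S p c m n),
      (∀ i, φ (MvPolynomial.X i) = gx S p c m n i) ∧
      (∀ j, ψ (MvPolynomial.X j) = gy S p c m n j) ∧
      (∀ f g, N (MvPolynomial.rename Sum.inl f * MvPolynomial.rename Sum.inr g) = φ f * ψ g) ∧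
      Function.Surjective N := by
  obtain ⟨φ, hφ⟩ := exists_algHom_of_commute (S := S) (gx S p c m n) gx_commute
  obtain ⟨ψ, hψ⟩ := exists_algHom_of_commute (S := S) (gy S p c m n) gy_commute
  let N : MvPolynomial (Fin m ⊕ Fin n) S →ₗ[S] Bmn S p c m n :=
    (MvPolynomial.basisMonomials (Fin m ⊕ Fin n) S).constr S fun e =>
      φ (MvPolynomial.monomial (e.comapDomain Sum.inl Sum.inl_injective.injOn) 1) *
        ψ (MvPolynomial.monomial (e.comapDomain Sum.inr Sum.inr_injective.injOn) 1)
  have hN : ∀ f g, N (MvPolynomial.rename Sum.inl f * MvPolynomial.rename Sum.inr g) =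
      φ f * ψ g := by
    intro f g
    induction f using MvPolynomial.induction_on' with
    | add f f' hf hf' => simp only [map_add, add_mul, hf, hf']
    | monomial u a =>
      induction g using MvPolynomial.induction_on' with
      | add g g' hg hg' => simp only [map_add, mul_add, hg, hg']
      | monomial v b =>
        have h1 : MvPolynomial.rename Sum.inl (MvPolynomial.monomial u a) *
            MvPolynomial.rename Sum.inr (MvPolynomial.monomial v b) =
            (a * b) • MvPolynomial.basisMonomials (Fin m ⊕ Fin n) S (Finsupp.sumElim u v) := by
          rw [MvPolynomial.rename_monomial, MvPolynomial.rename_monomial,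
            MvPolynomial.monomial_mul, Finsupp.sumElim_eq_add, MvPolynomial.coe_basisMonomials,
            MvPolynomial.smul_monomial, smul_eq_mul, mul_one]
        have h2 : φ (MvPolynomial.monomial u a) = a • φ (MvPolynomial.monomial u 1) := by
          rw [← map_smul, MvPolynomial.smul_monomial, smul_eq_mul, mul_one]
        have h3 : ψ (MvPolynomial.monomial v b) = b • ψ (MvPolynomial.monomial v 1) := by
          rw [← map_smul, MvPolynomial.smul_monomial, smul_eq_mul, mul_one]
        rw [h1, map_smul, Module.Basis.constr_basis, Finsupp.comapDomain_inl_sumElim,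
          Finsupp.comapDomain_inr_sumElim, h2, h3, smul_mul_smul_comm]
  refine ⟨φ, ψ, N, hφ, hψ, hN, ?_⟩
  rw [← LinearMap.range_eq_top, eq_top_iff, ← bmn_normal_ordering hc m n, Submodule.mul_le]
  have hx : Algebra.adjoin S (Set.range (gx S p c m n)) ≤ φ.range :=
    Algebra.adjoin_le (by rintro _ ⟨i, rfl⟩; exact ⟨_, hφ i⟩)
  have hy : Algebra.adjoin S (Set.range (gy S p c m n)) ≤ ψ.range :=
    Algebra.adjoin_le (by rintro _ ⟨i, rfl⟩; exact ⟨_, hψ i⟩)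
  intro u hu v hv
  obtain ⟨f, rfl⟩ := hx hu
  obtain ⟨g, rfl⟩ := hy hv
  exact ⟨_, hN f g⟩

section WeylRepresentation

variable {K : Type*} [CommRing K]

/-- Multiplication by polynomials in the first set of variables. -/
def weylX : MvPolynomial ℕ+ K →ₐ[K] Module.End K (MvPolynomial (ℕ+ ⊕ ℕ+) K) :=
  (Algebra.lmul K _).comp (MvPolynomial.rename Sum.inl)

theorem weylX_apply (f : MvPolynomial ℕ+ K) (v : MvPolynomial (ℕ+ ⊕ ℕ+) K) :
    weylX f v = MvPolynomial.rename Sum.inl f * v := rfl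

/-- The operator `l ∂/∂x_l + y_l`. -/
def weylOp (l : ℕ+) : Module.End K (MvPolynomial (ℕ+ ⊕ ℕ+) K) :=
  ((l : ℕ) : K) • (MvPolynomial.pderiv (Sum.inl l)).toLinearMap +
    Algebra.lmul K _ (MvPolynomial.X (Sum.inr l))

theorem weylOp_apply (l : ℕ+) (v : MvPolynomial (ℕ+ ⊕ ℕ+) K) :
    weylOp l v = ((l : ℕ) : K) • MvPolynomial.pderiv (Sum.inl l) v +
      MvPolynomial.X (Sum.inr l) * v := rfl

theorem pderiv_comm {σ : Type*} (i j : σ) (f : MvPolynomial σ K) :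
    MvPolynomial.pderiv i (MvPolynomial.pderiv j f) =
      MvPolynomial.pderiv j (MvPolynomial.pderiv i f) := by
  classical
  have : ⁅(MvPolynomial.pderiv i : Derivation K (MvPolynomial σ K) _),
      MvPolynomial.pderiv (R := K) j⁆ = 0 := by
    refine MvPolynomial.derivation_ext fun k => ?_
    rw [Derivation.commutator_apply, MvPolynomial.pderiv_X, MvPolynomial.pderiv_X]
    simp only [Pi.single_apply]
    split_ifs <;> simp
  have := DFunLike.congr_fun this f
  rw [Derivation.commutator_apply, Derivation.zero_apply] at this
  exact sub_eq_zero.1 this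

theorem weylOp_commute (k l : ℕ+) : (weylOp k * weylOp l : Module.End K _) =
    weylOp l * weylOp k := by
  refine LinearMap.ext fun v => ?_
  have h : ∀ i j : ℕ+, MvPolynomial.pderiv (R := K) (Sum.inl i : ℕ+ ⊕ ℕ+)
      (MvPolynomial.X (Sum.inr j)) = 0 :=
    fun i j => MvPolynomial.pderiv_X_of_ne (by simp)
  simp only [Module.End.mul_apply, weylOp_apply, map_add, Derivation.map_smul,
    Derivation.leibniz, h, smul_zero, add_zero, pderiv_comm (Sum.inl k) (Sum.inl l)]
  simp only [smul_eq_mul, Algebra.smul_def]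
  ring

theorem exists_weylY (K : Type*) [CommRing K] :
    ∃ D : MvPolynomial ℕ+ K →ₐ[K] Module.End K (MvPolynomial (ℕ+ ⊕ ℕ+) K),
      ∀ l, D (MvPolynomial.X l) = weylOp l :=
  exists_algHom_of_commute _ weylOp_commute

theorem weylOp_mul_weylX (k l : ℕ+) :
    weylOp l * weylX (MvPolynomial.X k) = weylX (MvPolynomial.X k) * weylOp l +
      if k = l then ((k : ℕ) : Module.End K (MvPolynomial (ℕ+ ⊕ ℕ+) K)) else 0 := by
  refine LinearMap.ext fun v => ?_
  simp only [Module.End.mul_apply, LinearMap.add_apply, weylOp_apply, weylX_apply,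
    MvPolynomial.rename_X, Derivation.leibniz]
  obtain rfl | h := eq_or_ne k l
  · rw [if_pos rfl, MvPolynomial.pderiv_X_self, Module.End.natCast_apply, nsmul_eq_mul]
    simp only [smul_eq_mul, Algebra.smul_def, map_natCast]
    ring
  · rw [if_neg h, MvPolynomial.pderiv_X_of_ne (by simpa using h)]
    simp only [smul_eq_mul, Algebra.smul_def, map_natCast, LinearMap.zero_apply]
    ring

theorem weyl_apply_one {D : MvPolynomial ℕ+ K →ₐ[K] Module.End K (MvPolynomial (ℕ+ ⊕ ℕ+) K)}
    (hD : ∀ l, D (MvPolynomial.X l) = weylOp l) (f g : MvPolynomial ℕ+ K) :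
    (weylX f * D g) 1 = MvPolynomial.rename Sum.inl f * MvPolynomial.rename Sum.inr g := by
  have h0 : ∀ (l : ℕ+) (h : MvPolynomial ℕ+ K),
      MvPolynomial.pderiv (Sum.inl l) (MvPolynomial.rename Sum.inr h : MvPolynomial (ℕ+ ⊕ ℕ+) K)
        = 0 := by
    intro l h
    induction h using MvPolynomial.induction_on with
    | C a => simp
    | add p q hp hq => simp [hp, hq]
    | mul_X p i hp =>
      rw [map_mul, Derivation.leibniz, hp, MvPolynomial.rename_X,
        MvPolynomial.pderiv_X_of_ne (by simp), smul_zero, smul_zero, add_zero]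
  have h : ∀ h : MvPolynomial ℕ+ K, D g (MvPolynomial.rename Sum.inr h) =
      MvPolynomial.rename Sum.inr (g * h) := by
    induction g using MvPolynomial.induction_on with
    | C a =>
      intro h
      rw [← MvPolynomial.algebraMap_eq, AlgHom.commutes, Module.algebraMap_end_apply,
        ← Algebra.smul_def, map_smul]
    | add p q hp hq => intro h; rw [map_add, LinearMap.add_apply, hp, hq, add_mul, map_add]
    | mul_X p i hp =>
      intro h
      rw [map_mul, hD, Module.End.mul_apply, weylOp_apply, h0, smul_zero, zero_add,
        ← MvPolynomial.rename_X (R := K) (Sum.inr : ℕ+ → ℕ+ ⊕ ℕ+), ← map_mul, hp, mul_assoc]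
  have h1 := h 1
  rw [map_one, mul_one] at h1
  rw [Module.End.mul_apply, h1, weylX_apply]

theorem weyl_cEval [Algebra ℚ K] {c : ℕ+ → ℕ+ → MvPolynomial (ℕ+ ⊕ₗ ℕ+) ℤ} (hc : IsCFamily c)
    {D : MvPolynomial ℕ+ K →ₐ[K] Module.End K (MvPolynomial (ℕ+ ⊕ ℕ+) K)}
    (hD : ∀ l, D (MvPolynomial.X l) = weylOp l) (α β : ℕ+ → K) (k l : ℕ+) :
    cEval (fun d => weylX (ghostInv (fun k => MvPolynomial.X k + MvPolynomial.C (α k)) d))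
      (fun e => D (ghostInv (fun k => MvPolynomial.X k + MvPolynomial.C (β k)) e)) (c k l) =
    D (ghostInv (fun k => MvPolynomial.X k + MvPolynomial.C (β k)) l) *
        weylX (ghostInv (fun k => MvPolynomial.X k + MvPolynomial.C (α k)) k) -
      weylX (ghostInv (fun k => MvPolynomial.X k + MvPolynomial.C (α k)) k) *
        D (ghostInv (fun k => MvPolynomial.X k + MvPolynomial.C (β k)) l) := by
  have hX : ∀ k, ghost (fun d => weylX (ghostInv (fun k => MvPolynomial.X k +
      MvPolynomial.C (α k)) d)) k = weylX (MvPolynomial.X k + MvPolynomial.C (α k)) := fun k =>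
    (map_ghost (weylX (K := K)).toRingHom _ k).symm.trans (congrArg weylX (ghost_ghostInv _ k))
  have hY : ∀ k, ghost (fun d => D (ghostInv (fun k => MvPolynomial.X k +
      MvPolynomial.C (β k)) d)) k = D (MvPolynomial.X k + MvPolynomial.C (β k)) := fun k =>
    (map_ghost D.toRingHom _ k).symm.trans (congrArg D (ghost_ghostInv _ k))
  refine cEval_of_ghost hc _ _ (fun k l => ?_) (fun k l => ?_) (fun k l => ?_) k l
  · rw [hX, hX, ← map_mul, mul_comm, map_mul]
  · rw [hY, hY, ← map_mul, mul_comm, map_mul]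
  · rw [hX, hY, map_add, map_add, hD, ← MvPolynomial.algebraMap_eq, AlgHom.commutes,
      AlgHom.commutes, add_mul, mul_add, mul_add,
      weylOp_mul_weylX, add_mul, mul_add, mul_add, Algebra.commutes (β l),
      Algebra.commutes (β l), ← Algebra.commutes (α k)]
    abel

end WeylRepresentation

theorem map_cEval_padicExtend {p : ℕ} {S A B : Type*} [CommRing S] [Ring A] [Algebra S A] [Ring B]
    [Algebra S B] (f : A →ₐ[S] B) {m n : ℕ} (x : Fin m → A) (y : Fin n → A)
    (q : MvPolynomial (ℕ+ ⊕ₗ ℕ+) ℤ) :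
    f (cEval (padicExtend p x) (padicExtend p y) q) =
      cEval (padicExtend p fun i => f (x i)) (padicExtend p fun j => f (y j)) q := by
  have h : ∀ {k : ℕ} (z : Fin k → A), (fun d => f (padicExtend p z d)) =
      padicExtend p fun i => f (z i) := by
    intro k z
    funext d
    unfold padicExtend
    split_ifs <;> simp
  rw [← h, ← h]
  exact map_cEval f.toRingHom _ _ _

theorem cEval_padicExtend {p : ℕ} [hp : Fact p.Prime]
    {c : ℕ+ → ℕ+ → MvPolynomial (ℕ+ ⊕ₗ ℕ+) ℤ} (hc : IsCFamily c) {A : Type*} [Ring A]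
    (x y : ℕ+ → A) {m n : ℕ} (i : Fin m) (j : Fin n) :
    cEval (padicExtend p fun i : Fin m => x (ppow p i))
      (padicExtend p fun j : Fin n => y (ppow p j))
      (c (ppow p i) (ppow p j)) = cEval x y (c (ppow p i) (ppow p j)) := by
  refine pEval_congr fun v hv => ?_
  obtain ⟨d, hd, -, h⟩ | ⟨d, hd, -, h⟩ := (hc _ _).1 v hv <;>
    obtain ⟨h1, h2⟩ := eq_ppow_of_dvd p hd
  · rw [h, Sum.elim_inl, Sum.elim_inl, padicExtend, dif_pos (h2.trans_lt i.2), ← h1]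
  · rw [h, Sum.elim_inr, Sum.elim_inr, padicExtend, dif_pos (h2.trans_lt j.2), ← h1]

theorem ghostComponent_map {p : ℕ} [Fact p.Prime] {A B : Type*} [CommRing A] [CommRing B]
    (f : A →+* B) (a : WittVector p A) (i : ℕ) :
    WittVector.ghostComponent i (WittVector.map f a) = f (WittVector.ghostComponent i a) := by
  simp [WittVector.ghostComponent_apply, aeval_wittPolynomial, WittVector.map_coeff]

/-- Translating the ghost coordinates by the ghost components of `a` amounts to adding the Witt
vector `a`. -/
theorem mk_ghostInv_add {p : ℕ} [hp : Fact p.Prime] {K : Type*} [CommRing K] [Algebra ℚ K]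
    (a : WittVector p K) :
    WittVector.mk p (fun j => ghostInv (fun k => (MvPolynomial.X k : MvPolynomial ℕ+ K) +
      MvPolynomial.C (WittVector.ghostComponent (padicValNat p k) a)) (ppow p j)) =
    WittVector.mk p (fun j => ghostInv (MvPolynomial.X : ℕ+ → MvPolynomial ℕ+ K) (ppow p j)) +
      WittVector.map MvPolynomial.C a := by
  refine ghostComponent_injective p fun i => ?_
  rw [map_add, ← ghost_ppow, ← ghost_ppow, ghost_ghostInv, ghost_ghostInv, padicValNat_ppow,
    ghostComponent_map]

theorem exists_aeval_ghostInv (p : ℕ) [hp : Fact p.Prime] (K : Type*) [CommRing K] [Algebra ℚ K] :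
    ∃ θ : MvPolynomial ℕ+ K →ₐ[K] MvPolynomial ℕ K,
      ∀ i, θ (ghostInv MvPolynomial.X (ppow p i)) = MvPolynomial.X i := by
  let θ : MvPolynomial ℕ+ K →ₐ[K] MvPolynomial ℕ K := MvPolynomial.aeval fun k =>
    WittVector.ghostComponent (padicValNat p k) (WittVector.mk p MvPolynomial.X)
  have h : WittVector.mk p (fun i => θ (ghostInv MvPolynomial.X (ppow p i))) =
      WittVector.mk p MvPolynomial.X := by
    refine ghostComponent_injective p fun i => ?_
    have h1 := map_ghost θ.toRingHom (ghostInv MvPolynomial.X) (ppow p i)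
    rw [ghost_ghostInv, ghost_ppow] at h1
    refine h1.symm.trans ?_
    simp [θ, padicValNat_ppow]
  exact ⟨θ, fun i => by simpa using congrArg (WittVector.coeff · i) h⟩

theorem mvPolynomial_sum_induction {σ τ S : Type*} [CommRing S]
    {P : MvPolynomial (σ ⊕ τ) S → Prop}
    (h : ∀ f g, P (MvPolynomial.rename Sum.inl f * MvPolynomial.rename Sum.inr g))
    (hadd : ∀ q r, P q → P r → P (q + r)) (q : MvPolynomial (σ ⊕ τ) S) : P q := by
  induction q using MvPolynomial.induction_on' with
  | add q r hq hr => exact hadd q r hq hr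
  | monomial e s =>
    obtain ⟨⟨u, v⟩, rfl⟩ := Finsupp.sumFinsuppEquivProdFinsupp.symm.surjective e
    convert h (MvPolynomial.monomial u s) (MvPolynomial.monomial v 1) using 1
    rw [MvPolynomial.rename_monomial, MvPolynomial.rename_monomial, MvPolynomial.monomial_mul,
      mul_one, ← Finsupp.sumElim_eq_add]
    rfl

section WeylEmbedding

variable {p : ℕ} [hp : Fact p.Prime] {c : ℕ+ → ℕ+ → MvPolynomial (ℕ+ ⊕ₗ ℕ+) ℤ}
  {S K : Type*} [CommRing S] [CommRing K] [Algebra S K] [Algebra ℚ K]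
  {D : MvPolynomial ℕ+ K →ₐ[K] Module.End K (MvPolynomial (ℕ+ ⊕ ℕ+) K)}

theorem exists_weyl_lift (hc : IsCFamily c) (hD : ∀ l, D (MvPolynomial.X l) = weylOp l)
    (m n : ℕ) :
    ∃ ρ : Bmn S p c m n →ₐ[S] Module.End K (MvPolynomial (ℕ+ ⊕ ℕ+) K),
      (∀ i : Fin m, ρ (gx S p c m n i) = weylX (ghostInv MvPolynomial.X (ppow p i))) ∧
      ∀ j : Fin n, ρ (gy S p c m n j) = D (ghostInv MvPolynomial.X (ppow p j)) := by
  have h := weyl_cEval hc hD 0 0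
  simp only [Pi.zero_apply, map_zero, add_zero] at h
  refine exists_bmn_lift _ _ (fun i i' => ?_) (fun j j' => ?_) (fun i j => ?_)
  · rw [← map_mul, mul_comm, map_mul]
  · rw [← map_mul, mul_comm, map_mul]
  · have h1 := cEval_padicExtend (p := p) hc (fun k => weylX (ghostInv MvPolynomial.X k))
      (fun k => D (ghostInv MvPolynomial.X k)) i j
    rw [h1, h, add_sub_cancel]

theorem weyl_lift_injective (hc : IsCFamily c) (hinj : Function.Injective (algebraMap S K))
    (hD : ∀ l, D (MvPolynomial.X l) = weylOp l) {m n : ℕ}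
    {ρ : Bmn S p c m n →ₐ[S] Module.End K (MvPolynomial (ℕ+ ⊕ ℕ+) K)}
    (hx : ∀ i : Fin m, ρ (gx S p c m n i) = weylX (ghostInv MvPolynomial.X (ppow p i)))
    (hy : ∀ j : Fin n, ρ (gy S p c m n j) = D (ghostInv MvPolynomial.X (ppow p j))) :
    Function.Injective ρ := by
  obtain ⟨φ, ψ, N, hφ, hψ, hN, hsurj⟩ := exists_normal_ordering_map (S := S) (p := p) hc m n
  obtain ⟨θ, hθ⟩ := exists_aeval_ghostInv p K
  let Θ : MvPolynomial (ℕ+ ⊕ ℕ+) K →ₐ[K] MvPolynomial (ℕ ⊕ ℕ) K := MvPolynomial.aeval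
    (Sum.elim (fun k => MvPolynomial.rename Sum.inl (θ (MvPolynomial.X k)))
      (fun k => MvPolynomial.rename Sum.inr (θ (MvPolynomial.X k))))
  have hl : ∀ f, Θ (MvPolynomial.rename Sum.inl f) = MvPolynomial.rename Sum.inl (θ f) :=
    fun f => DFunLike.congr_fun (MvPolynomial.algHom_ext
      (f := Θ.comp (MvPolynomial.rename Sum.inl)) (g := (MvPolynomial.rename Sum.inl).comp θ)
      (by simp [Θ])) f
  have hr : ∀ f, Θ (MvPolynomial.rename Sum.inr f) = MvPolynomial.rename Sum.inr (θ f) :=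
    fun f => DFunLike.congr_fun (MvPolynomial.algHom_ext
      (f := Θ.comp (MvPolynomial.rename Sum.inr)) (g := (MvPolynomial.rename Sum.inr).comp θ)
      (by simp [Θ])) f
  let ev (k : ℕ) : MvPolynomial (Fin k) S →ₐ[S] MvPolynomial ℕ+ K :=
    MvPolynomial.aeval fun i => ghostInv MvPolynomial.X (ppow p i)
  have hev : ∀ k f, θ (ev k f) =
      MvPolynomial.rename Fin.val (MvPolynomial.map (algebraMap S K) f) := by
    intro k f
    induction f using MvPolynomial.induction_on with
    | C s =>
      rw [← MvPolynomial.algebraMap_eq, AlgHom.commutes, MvPolynomial.algebraMap_eq,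
        MvPolynomial.map_C, MvPolynomial.rename_C, MvPolynomial.algebraMap_apply,
        ← MvPolynomial.algebraMap_eq, AlgHom.commutes, MvPolynomial.algebraMap_eq]
    | add f g hf hg => simp only [map_add, hf, hg]
    | mul_X f i hf => rw [map_mul, map_mul, map_mul, map_mul, hf]; simp [ev, hθ]
  have hρφ : ∀ f, ρ (φ f) = weylX (ev m f) :=
    fun f => DFunLike.congr_fun (MvPolynomial.algHom_ext
      (f := ρ.comp φ) (g := (weylX.restrictScalars S).comp (ev m))
      (by simp [hφ, hx, ev])) f
  have hρψ : ∀ f, ρ (ψ f) = D (ev n f) :=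
    fun f => DFunLike.congr_fun (MvPolynomial.algHom_ext
      (f := ρ.comp ψ) (g := (D.restrictScalars S).comp (ev n))
      (by simp [hψ, hy, ev])) f
  have key : ∀ q, Θ (ρ (N q) 1) = MvPolynomial.rename (Sum.map Fin.val Fin.val)
      (MvPolynomial.map (algebraMap S K) q) := by
    intro q
    induction q using mvPolynomial_sum_induction with
    | h f g =>
      rw [hN, map_mul, hρφ, hρψ, weyl_apply_one hD, map_mul, hl, hr, hev, hev, map_mul, map_mul]
      simp only [MvPolynomial.map_rename, MvPolynomial.rename_rename]
      rfl
    | hadd q r hq hr => simp only [map_add, LinearMap.add_apply, hq, hr]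
  rw [injective_iff_map_eq_zero]
  intro z hz
  obtain ⟨q, rfl⟩ := hsurj z
  have h := key q
  rw [hz, LinearMap.zero_apply, map_zero, eq_comm, map_eq_zero_iff _
    (MvPolynomial.rename_injective _ (Fin.val_injective.sumMap Fin.val_injective)),
    map_eq_zero_iff _ (MvPolynomial.map_injective _ hinj)] at h
  rw [h, map_zero]

/-- The translated generators satisfy the commutation relation, over rings embedding in a
`ℚ`-algebra. -/
theorem wittShift_relation_of_injective (hc : IsCFamily c)
    (hinj : Function.Injective (algebraMap S K)) (a b : WittVector p S) {m n : ℕ}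
    (i : Fin m) (j : Fin n) :
    wittShift (gy S p c m n) b j * wittShift (gx S p c m n) a i =
      wittShift (gx S p c m n) a i * wittShift (gy S p c m n) b j +
        cEval (padicExtend p fun i : Fin m => wittShift (gx S p c m n) a i)
          (padicExtend p fun j : Fin n => wittShift (gy S p c m n) b j)
          (c (ppow p i) (ppow p j)) := by
  obtain ⟨D, hD⟩ := exists_weylY K
  obtain ⟨ρ, hx, hy⟩ := exists_weyl_lift (S := S) (p := p) hc hD m n
  apply weyl_lift_injective hc hinj hD hx hy
  let α (a : WittVector p S) (k : ℕ+) : K :=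
    WittVector.ghostComponent (padicValNat p k) (WittVector.map (algebraMap S K) a)
  let ξ (a : WittVector p S) : ℕ+ → MvPolynomial ℕ+ K :=
    ghostInv fun k => MvPolynomial.X k + MvPolynomial.C (α a k)
  have shift : ∀ (F : MvPolynomial ℕ+ K →ₐ[K] Module.End K (MvPolynomial (ℕ+ ⊕ ℕ+) K)) (k : ℕ)
      (z : Fin k → Bmn S p c m n) (hz : ∀ i, ρ (z i) = F (ghostInv MvPolynomial.X (ppow p i)))
      (a : WittVector p S) (i : Fin k), ρ (wittShift z a i) = F (ξ a (ppow p i)) := by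
    intro F k z hz a i
    have h1 : ρ (wittShift z a i) = wittShift (fun k => ρ (z k)) a i :=
      map_wittShift ρ.toRingHom z a a (fun k => ρ.commutes _) i
    rw [h1, wittShift_eq F.toRingHom (WittVector.mk p fun j => ghostInv MvPolynomial.X (ppow p j))
      (WittVector.map MvPolynomial.C (WittVector.map (algebraMap S K) a)) (fun k => (hz k).symm)
      (fun k => ?_) i.2, ← mk_ghostInv_add]
    · rfl
    · rw [WittVector.map_coeff, WittVector.map_coeff, ← MvPolynomial.algebraMap_eq]
      exact (F.commutes _).trans (IsScalarTower.algebraMap_apply S K _ _).symm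
  have sx := shift weylX m (gx S p c m n) hx a
  have sy := shift D n (gy S p c m n) hy b
  rw [map_add, map_mul, map_mul, map_cEval_padicExtend]
  simp only [sx, sy]
  rw [cEval_padicExtend (p := p) hc (fun k => weylX (ξ a k)) (fun k => D (ξ b k)),
    weyl_cEval hc hD, add_sub_cancel]

end WeylEmbedding

theorem wittShift_relation {p : ℕ} [hp : Fact p.Prime]
    {c : ℕ+ → ℕ+ → MvPolynomial (ℕ+ ⊕ₗ ℕ+) ℤ} (hc : IsCFamily c) {R : Type*} [CommRing R]
    (a b : WittVector p R) {m n : ℕ} (i : Fin m) (j : Fin n) :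
    wittShift (gy R p c m n) b j * wittShift (gx R p c m n) a i =
      wittShift (gx R p c m n) a i * wittShift (gy R p c m n) b j +
        cEval (padicExtend p fun i : Fin m => wittShift (gx R p c m n) a i)
          (padicExtend p fun j : Fin n => wittShift (gy R p c m n) b j)
          (c (ppow p i) (ppow p j)) := by
  let π : MvPolynomial R ℤ →+* R := MvPolynomial.eval₂Hom (Int.castRingHom R) id
  have hπ : ∀ r, π (MvPolynomial.X r) = r := fun r => by simp [π]
  let _ : Algebra (MvPolynomial R ℤ) (Bmn R p c m n) := Algebra.compHom _ π
  let lift (a : WittVector p R) : WittVector p (MvPolynomial R ℤ) :=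
    WittVector.mk p fun k => MvPolynomial.X (a.coeff k)
  obtain ⟨f, hx, hy⟩ := exists_bmn_lift (S := MvPolynomial R ℤ) (p := p) (c := c)
    (gx R p c m n) (gy R p c m n) gx_commute gy_commute gy_mul_gx
  have hlift : ∀ (a : WittVector p R) (k : ℕ),
      f (algebraMap (MvPolynomial R ℤ) _ ((lift a).coeff k)) =
        algebraMap R (Bmn R p c m n) (a.coeff k) := by
    intro a k
    rw [AlgHom.commutes]
    exact congrArg (algebraMap R (Bmn R p c m n)) (hπ _)
  have sx : ∀ i, f (wittShift (gx (MvPolynomial R ℤ) p c m n) (lift a) i) =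
      wittShift (gx R p c m n) a i := fun i => by
    rw [← funext hx]
    exact map_wittShift f.toRingHom _ _ _ (hlift a) i
  have sy : ∀ j, f (wittShift (gy (MvPolynomial R ℤ) p c m n) (lift b) j) =
      wittShift (gy R p c m n) b j := fun j => by
    rw [← funext hy]
    exact map_wittShift f.toRingHom _ _ _ (hlift b) j
  let _ : Algebra (MvPolynomial R ℤ) (MvPolynomial R ℚ) :=
    (MvPolynomial.map (Int.castRingHom ℚ)).toAlgebra
  have h := congrArg f (wittShift_relation_of_injective (K := MvPolynomial R ℚ) hc
    (MvPolynomial.map_injective _ Int.cast_injective) (lift a) (lift b) i j)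
  rw [map_add, map_mul, map_mul, map_cEval_padicExtend] at h
  simpa only [sx, sy] using h

/-- Translation by Witt vectors as an endomorphism of `B_{m,n}(R)`. -/
theorem exists_translation {p : ℕ} [hp : Fact p.Prime]
    {c : ℕ+ → ℕ+ → MvPolynomial (ℕ+ ⊕ₗ ℕ+) ℤ} (hc : IsCFamily c) {R : Type*} [CommRing R]
    (m n : ℕ) (a b : WittVector p R) :
    ∃ τ : Bmn R p c m n →ₐ[R] Bmn R p c m n,
      (∀ i, τ (gx R p c m n i) = wittShift (gx R p c m n) a i) ∧
      ∀ j, τ (gy R p c m n j) = wittShift (gy R p c m n) b j :=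
  exists_bmn_lift _ _ (fun i i' => wittShift_commute gx_commute a i.2 i'.2)
    (fun j j' => wittShift_commute gy_commute b j.2 j'.2) (wittShift_relation hc a b)

theorem comp_eq_id_of_translation {p : ℕ} [hp : Fact p.Prime]
    {c : ℕ+ → ℕ+ → MvPolynomial (ℕ+ ⊕ₗ ℕ+) ℤ} {R : Type*} [CommRing R] {m n : ℕ}
    {a b : WittVector p R} {τ τ' : Bmn R p c m n →ₐ[R] Bmn R p c m n}
    (hx : ∀ i, τ (gx R p c m n i) = wittShift (gx R p c m n) (-a) i)
    (hy : ∀ j, τ (gy R p c m n j) = wittShift (gy R p c m n) (-b) j)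
    (hx' : ∀ i, τ' (gx R p c m n i) = wittShift (gx R p c m n) a i)
    (hy' : ∀ j, τ' (gy R p c m n j) = wittShift (gy R p c m n) b j) :
    τ.comp τ' = AlgHom.id R _ := by
  refine AlgHom.ext_of_adjoin_eq_top bmn_adjoin_eq_top ?_
  rintro _ (⟨i, rfl⟩ | ⟨j, rfl⟩)
  · have h : τ (wittShift (gx R p c m n) a i) = wittShift (fun k => τ (gx R p c m n k)) a i :=
      map_wittShift τ.toRingHom _ a a (fun k => τ.commutes _) i
    rw [AlgHom.comp_apply, hx', h, funext hx, wittShift_neg_cancel gx_commute, AlgHom.id_apply]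
  · have h : τ (wittShift (gy R p c m n) b j) = wittShift (fun k => τ (gy R p c m n k)) b j :=
      map_wittShift τ.toRingHom _ b b (fun k => τ.commutes _) j
    rw [AlgHom.comp_apply, hy', h, funext hy, wittShift_neg_cancel gy_commute, AlgHom.id_apply]

theorem exists_wittVector_lift {p : ℕ} [Fact p.Prime] {R : Type*} [CommRing R] {m : ℕ}
    (a : TruncatedWittVector p m R) :
    ∃ u : WittVector p R, ∀ k, u.coeff k = if h : k < m then a.coeff ⟨k, h⟩ else 0 :=
  ⟨WittVector.mk p fun k => if h : k < m then a.coeff ⟨k, h⟩ else 0, fun _ => rfl⟩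

/-- Fix a prime `p`, `m, n ∈ ℕ`, a commutative ring `R` and truncated `p`-typical Witt
vectors `a ∈ W_m(R)`, `b ∈ W_n(R)`.  There is an `R`-algebra automorphism of `B_{m,n}(R)`
sending each generator `x_i` to the `i`-th `p`-typical Witt addition polynomial evaluated
at `(x_0, …, x_i, a_0, …, a_i)` and each generator `y_j` to the `j`-th Witt addition
polynomial evaluated at `(y_0, …, y_j, b_0, …, b_j)`; that is,
`B_{m,n}(R)(x, y) = B_{m,n}(R)(x + a, y + b)`. -/
theorem bmn_translation_automorphism (p : ℕ) [Fact p.Prime] (R : Type*) [CommRing R]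
    (m n : ℕ) (c : ℕ+ → ℕ+ → MvPolynomial (ℕ+ ⊕ₗ ℕ+) ℤ) (hc : IsCFamily c)
    (a : TruncatedWittVector p m R) (b : TruncatedWittVector p n R) :
    ∃ φ : Bmn R p c m n ≃ₐ[R] Bmn R p c m n,
      (∀ i : Fin m, φ (gx R p c m n i) =
        pEval (addSubstX R p c m n a)
          (MvPolynomial.rename (toLex : Fin 2 × ℕ → Fin 2 ×ₗ ℕ) (WittVector.wittAdd p i))) ∧
      (∀ j : Fin n, φ (gy R p c m n j) =
        pEval (addSubstY R p c m n b)
          (MvPolynomial.rename (toLex : Fin 2 × ℕ → Fin 2 ×ₗ ℕ) (WittVector.wittAdd p j))) := by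
  obtain ⟨u, hu⟩ := exists_wittVector_lift a
  obtain ⟨v, hv⟩ := exists_wittVector_lift b
  obtain ⟨τ, hx, hy⟩ := exists_translation hc m n u v
  obtain ⟨τ', hx', hy'⟩ := exists_translation hc m n (-u) (-v)
  refine ⟨AlgEquiv.ofAlgHom τ τ'
    (comp_eq_id_of_translation (a := -u) (b := -v) (by simpa using hx) (by simpa using hy) hx' hy')
    (comp_eq_id_of_translation hx' hy' hx hy), fun i => (hx i).trans ?_, fun j => (hy j).trans ?_⟩
  · unfold wittShift
    congr 1
    funext w
    rw [addSubstX, hu]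
    split_ifs <;> simp
  · unfold wittShift
    congr 1
    funext w
    rw [addSubstY, hv]
    split_ifs <;> simp

end
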